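/- Let T > 0 and let g be a Preisach density with Lipschitz bound μ ∈ L¹(0,∞), M = ∫₀^∞ μ(r) dr, which additionally satisfies ∫₀^∞ (sup_{v∈ℝ} g(r,v) − inf_{v∈ℝ} g(r,v)) dr = M₁ < ∞. Let b₁, b₂ ∈ C[0,T] with 0 ≤ b_i(t) ≤ b̄ for all t ∈ [0,T], i = 1,2, and let w₁, w₂ ∈ C[0,T]. Let q₁, q₂ : [0,T] → ℝ be absolutely continuous, for i = 1,2 and each r > 0 let ξ_r^i be the solution of the play variational inequality with threshold r and input q_i, set P[q_i](t) := ∫₀^∞ g(r, ξ_r^i(t)) dr, and suppose q_i(t) + b_i(t)·P[q_i](t) = w_i(t) for all t ∈ [0,T], i = 1,2. Then max_{t∈[0,T]} |q₁(t) − q₂(t)| ≤ exp(b̄ M)·( max_{t∈[0,T]} |w₁(t) − w₂(t)| + M₁ · max_{t∈[0,T]} |b₁(t) − b₂(t)| ). -/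

import Mathlib

open MeasureTheory Set

/-- `q` is absolutely continuous on `[0,T]` with a.e. derivative `q'`,
encoded via the fundamental theorem of calculus. -/
def IsACOn (T : ℝ) (q q' : ℝ → ℝ) : Prop :=
  IntegrableOn q' (Icc 0 T) ∧ ∀ t ∈ Icc 0 T, q t = q 0 + ∫ τ in (0:ℝ)..t, q' τ

/-- `ξ` (with a.e. derivative `ξ'`) solves the play variational inequality
with threshold `r` and input `q` on `[0,T]`:
(i) `|q - ξ| ≤ r` on `[0,T]`, (ii) `ξ'(t)(q(t) - ξ(t) - r z) ≥ 0` for a.e. `t`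
and all `z ∈ [-1,1]`, (iii) `ξ(0) = max{q(0) - r, min{0, q(0) + r}}`. -/
def IsPlaySol (T r : ℝ) (q ξ ξ' : ℝ → ℝ) : Prop :=
  IsACOn T ξ ξ' ∧
  (∀ t ∈ Icc 0 T, |q t - ξ t| ≤ r) ∧
  (∀ᵐ t ∂(volume.restrict (Ioo 0 T)),
    ∀ z ∈ Icc (-1:ℝ) 1, ξ' t * (q t - ξ t - r * z) ≥ 0) ∧
  ξ 0 = max (q 0 - r) (min 0 (q 0 + r))

/-- `g : (0,∞) × ℝ → ℝ` is a Preisach density with Lipschitz bound `μ`: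
`g` is measurable, `μ ∈ L¹(0,∞)`, and for a.e. `r > 0` one has `g(r,0) = 0`
and `v ↦ g(r,v)` is nondecreasing and Lipschitz with constant `μ(r) ≥ 0`. -/
def IsPreisachDensity (g : ℝ → ℝ → ℝ) (μ : ℝ → ℝ) : Prop :=
  Measurable (Function.uncurry g) ∧
  IntegrableOn μ (Ioi 0) ∧
  ∀ᵐ r ∂(volume.restrict (Ioi (0:ℝ))),
    g r 0 = 0 ∧ 0 ≤ μ r ∧ Monotone (g r) ∧
      LipschitzWith (Real.toNNReal (μ r)) (g r)


namespace IsACOn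

variable {T : ℝ} {q q' p p' : ℝ → ℝ}

theorem intervalIntegrable (h : IsACOn T q q') {s t : ℝ} (hs : s ∈ Icc 0 T) (ht : t ∈ Icc 0 T) :
    IntervalIntegrable q' volume s t :=
  (h.1.mono_set (uIcc_subset_Icc hs ht)).intervalIntegrable

theorem sub_eq_integral (h : IsACOn T q q') {s t : ℝ} (hs : s ∈ Icc 0 T) (ht : t ∈ Icc 0 T) :
    q t - q s = ∫ τ in s..t, q' τ := by
  have h0 : (0 : ℝ) ∈ Icc 0 T := ⟨le_rfl, hs.1.trans hs.2⟩
  rw [h.2 t ht, h.2 s hs, ← intervalIntegral.integral_interval_sub_left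
    (h.intervalIntegrable h0 ht) (h.intervalIntegrable h0 hs)]
  ring

theorem sub (hq : IsACOn T q q') (hp : IsACOn T p p') :
    IsACOn T (fun t => q t - p t) (fun t => q' t - p' t) := by
  refine ⟨hq.1.sub hp.1, fun t ht => ?_⟩
  have h0 : (0 : ℝ) ∈ Icc 0 T := ⟨le_rfl, ht.1.trans ht.2⟩
  rw [intervalIntegral.integral_sub (hq.intervalIntegrable h0 ht) (hp.intervalIntegrable h0 ht)]
  linarith [hq.2 t ht, hp.2 t ht]

theorem continuousOn (h : IsACOn T q q') : ContinuousOn q (Icc 0 T) := by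
  rcases lt_or_ge T 0 with hT | hT
  · simp [Icc_eq_empty hT.not_ge]
  have hc := intervalIntegral.continuousOn_primitive_interval (a := 0) (b := T) (f := q')
    (μ := volume) (by rw [uIcc_of_le hT]; exact h.1)
  rw [uIcc_of_le hT] at hc
  exact (continuousOn_const.add hc).congr h.2

theorem le_of_deriv_nonneg (h : IsACOn T q q') {s t : ℝ} (hs : 0 ≤ s) (hst : s ≤ t) (ht : t ≤ T)
    (hd : ∀ᵐ τ ∂(volume.restrict (Ioo 0 T)), τ ∈ Ioo s t → 0 ≤ q' τ) : q s ≤ q t := by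
  have hi := h.sub_eq_integral (s := s) (t := t) ⟨hs, hst.trans ht⟩ ⟨hs.trans hst, ht⟩
  have hd' : ∀ᵐ τ ∂(volume.restrict (Ioo s t)), 0 ≤ q' τ :=
    (ae_restrict_iff' measurableSet_Ioo).2 <| by
      filter_upwards [(ae_restrict_iff' measurableSet_Ioo).1 hd] with τ hτ hτ'
      exact hτ ⟨hs.trans_lt hτ'.1, hτ'.2.trans_le ht⟩ hτ'
  have : 0 ≤ ∫ τ in s..t, q' τ := by
    rw [intervalIntegral.integral_of_le hst, integral_Ioc_eq_integral_Ioo]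
    exact integral_nonneg_of_ae hd'
  linarith

/-- A function that cannot decrease below the level `c` stays above `c` once it is there. -/
theorem le_of_deriv_nonneg_below (h : IsACOn T q q') {c s t : ℝ} (hs : 0 ≤ s) (hst : s ≤ t)
    (ht : t ≤ T)
    (hd : ∀ᵐ τ ∂(volume.restrict (Ioo 0 T)), τ ∈ Ioo s t → q τ < c → 0 ≤ q' τ)
    (hc : c ≤ q s) : c ≤ q t := by
  have hcont : ContinuousOn q (Icc s t) := h.continuousOn.mono (Icc_subset_Icc hs ht)
  have hcomp : IsCompact (Icc s t ∩ q ⁻¹' Ici c) :=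
    isCompact_Icc.of_isClosed_subset (hcont.preimage_isClosed_of_isClosed isClosed_Icc isClosed_Ici)
      inter_subset_left
  obtain ⟨u, ⟨hu, huc⟩, hmax⟩ := hcomp.exists_isGreatest ⟨s, ⟨le_rfl, hst⟩, hc⟩
  refine le_trans huc (h.le_of_deriv_nonneg (hs.trans hu.1) hu.2 ht ?_)
  filter_upwards [hd] with τ hτ hτu
  refine hτ ⟨hu.1.trans_lt hτu.1, hτu.2⟩ (lt_of_not_ge fun hcτ => ?_)
  exact (hmax ⟨⟨hu.1.trans hτu.1.le, hτu.2.le⟩, hcτ⟩).not_gt hτu.1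

end IsACOn

namespace IsPlaySol

variable {T r ρ : ℝ} {q q₁ q₂ ξ ξ₁ ξ₂ η ξ' ξ₁' ξ₂' η' : ℝ → ℝ}

theorem ae_mul_nonneg (hr : 0 < r) (h₁ : IsPlaySol T r q₁ ξ₁ ξ₁') (h₂ : IsPlaySol T r q₂ ξ₂ ξ₂') :
    ∀ᵐ τ ∂(volume.restrict (Ioo 0 T)),
      0 ≤ ξ₁' τ * ((q₁ τ - q₂ τ) - (ξ₁ τ - ξ₂ τ)) := by
  filter_upwards [h₁.2.2.1, ae_restrict_mem measurableSet_Ioo] with τ hτ hτT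
  have hb := abs_le.1 (h₂.2.1 τ (Ioo_subset_Icc_self hτT))
  have := hτ ((q₂ τ - ξ₂ τ) / r) ⟨by rw [le_div_iff₀ hr]; linarith, by
    rw [div_le_iff₀ hr]; linarith⟩
  rw [mul_div_cancel₀ _ hr.ne'] at this
  convert this using 2
  ring

theorem ae_mono_of_lt (hr : 0 < r) (h₁ : IsPlaySol T r q₁ ξ₁ ξ₁') (h₂ : IsPlaySol T r q₂ ξ₂ ξ₂') :
    ∀ᵐ τ ∂(volume.restrict (Ioo 0 T)),
      ξ₁ τ - ξ₂ τ < q₁ τ - q₂ τ → 0 ≤ ξ₁' τ ∧ ξ₂' τ ≤ 0 := by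
  filter_upwards [ae_mul_nonneg hr h₁ h₂, ae_mul_nonneg hr h₂ h₁] with τ h1 h2 hlt
  constructor
  · exact nonneg_of_mul_nonneg_left h1 (by linarith)
  · by_contra! hpos
    nlinarith

theorem sub_nonneg_below (hr : 0 < r) (h₁ : IsPlaySol T r q₁ ξ₁ ξ₁')
    (h₂ : IsPlaySol T r q₂ ξ₂ ξ₂') {c u t : ℝ} (hu : 0 ≤ u) (hut : u ≤ t) (ht : t ≤ T)
    (hQ : ∀ s ∈ Ioc u t, c < q₁ s - q₂ s) (hc : c ≤ ξ₁ u - ξ₂ u) : c ≤ ξ₁ t - ξ₂ t := by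
  refine (h₁.1.sub h₂.1).le_of_deriv_nonneg_below hu hut ht ?_ hc
  filter_upwards [ae_mono_of_lt hr h₁ h₂] with τ hτ hτu hlt
  have := hτ (hlt.trans (hQ τ ⟨hτu.1, hτu.2.le⟩))
  linarith [this.1, this.2]

theorem exists_input_sub_le (hr : 0 < r) (h₁ : IsPlaySol T r q₁ ξ₁ ξ₁')
    (h₂ : IsPlaySol T r q₂ ξ₂ ξ₂') {c t : ℝ} (hc : c < 0) (ht : t ∈ Icc 0 T)
    (hlt : ξ₁ t - ξ₂ t < c) : ∃ s ∈ Icc 0 t, q₁ s - q₂ s ≤ c := by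
  by_contra! hno
  refine hlt.not_ge (sub_nonneg_below hr h₁ h₂ le_rfl ht.1 ht.2
    (fun s hs => hno s ⟨hs.1.le, hs.2⟩) ?_)
  have h0 := hno 0 ⟨le_rfl, ht.1⟩
  rw [h₁.2.2.2, h₂.2.2.2]
  grind

theorem mono_of_input_sub_lt (hr : 0 < r) (h₁ : IsPlaySol T r q₁ ξ₁ ξ₁')
    (h₂ : IsPlaySol T r q₂ ξ₂ ξ₂') {c u t : ℝ} (hu : 0 ≤ u) (hut : u ≤ t) (ht : t ≤ T)
    (hlt : ξ₁ t - ξ₂ t < c) (hQ : ∀ s ∈ Ioc u t, c < q₁ s - q₂ s) :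
    ξ₁ u ≤ ξ₁ t ∧ ξ₂ t ≤ ξ₂ u := by
  have hd : ∀ᵐ τ ∂(volume.restrict (Ioo 0 T)), τ ∈ Ioo u t → 0 ≤ ξ₁' τ ∧ ξ₂' τ ≤ 0 := by
    filter_upwards [ae_mono_of_lt hr h₁ h₂] with τ hτ hτu
    refine hτ (lt_trans (lt_of_not_ge fun hge => hlt.not_ge ?_) (hQ τ ⟨hτu.1, hτu.2.le⟩))
    exact sub_nonneg_below hr h₁ h₂ (hu.trans hτu.1.le) hτu.2.le ht
      (fun s hs => hQ s ⟨hτu.1.trans hs.1, hs.2⟩) hge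
  refine ⟨h₁.1.le_of_deriv_nonneg hu hut ht (hd.mono fun τ h hτ => (h hτ).1), ?_⟩
  have h0 : IsACOn T (fun _ => 0) (fun _ => 0) := ⟨integrableOn_zero, by simp⟩
  have := (h0.sub h₂.1).le_of_deriv_nonneg hu hut ht
    (hd.mono fun τ h hτ => by linarith [(h hτ).2])
  linarith

theorem abs_sub_le_of_le (hρ : 0 < ρ) (hρr : ρ ≤ r) (h : IsPlaySol T r q ξ ξ')
    (k : IsPlaySol T ρ q η η') {t : ℝ} (ht : t ∈ Icc 0 T) : |ξ t - η t| ≤ r - ρ := by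
  have hr : 0 < r := hρ.trans_le hρr
  have key : ∀ᵐ τ ∂(volume.restrict (Ioo 0 T)),
      (r - ρ < ξ τ - η τ → ξ' τ ≤ 0 ∧ 0 ≤ η' τ) ∧
      (r - ρ < η τ - ξ τ → 0 ≤ ξ' τ ∧ η' τ ≤ 0) := by
    filter_upwards [h.2.2.1, k.2.2.1, ae_restrict_mem measurableSet_Ioo] with τ hτ kτ hτT
    have hb := abs_le.1 (h.2.1 τ (Ioo_subset_Icc_self hτT))
    have kb := abs_le.1 (k.2.1 τ (Ioo_subset_Icc_self hτT))
    have h1 := hτ ((q τ - η τ) / r) ⟨by rw [le_div_iff₀ hr]; linarith, by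
      rw [div_le_iff₀ hr]; linarith⟩
    rw [mul_div_cancel₀ _ hr.ne'] at h1
    have k1 := kτ 1 ⟨by norm_num, le_rfl⟩
    have k2 := kτ (-1) ⟨le_rfl, by norm_num⟩
    refine ⟨fun hlt => ⟨?_, ?_⟩, fun hlt => ⟨?_, ?_⟩⟩
    · by_contra! hn
      nlinarith
    · by_contra! hn
      nlinarith
    · by_contra! hn
      nlinarith
    · by_contra! hn
      nlinarith
  have h0 : |ξ 0 - η 0| ≤ r - ρ := by
    rw [h.2.2.2, k.2.2.2, abs_le]
    grind
  rw [abs_le] at h0 ⊢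
  constructor
  · refine (h.1.sub k.1).le_of_deriv_nonneg_below le_rfl ht.1 ht.2 ?_ h0.1
    filter_upwards [key] with τ hτ _ hlt
    have := hτ.2 (by linarith)
    linarith [this.1, this.2]
  · have : -(r - ρ) ≤ η t - ξ t := by
      refine (k.1.sub h.1).le_of_deriv_nonneg_below le_rfl ht.1 ht.2 ?_ (by linarith [h0.2])
      filter_upwards [key] with τ hτ _ hlt
      have := hτ.1 (by linarith)
      linarith [this.1, this.2]
    linarith

theorem continuousOn_threshold {ξ : ℝ → ℝ → ℝ} (h : ∀ ρ : ℝ, 0 < ρ → ∃ d, IsPlaySol T ρ q (ξ ρ) d)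
    {t : ℝ} (ht : t ∈ Icc 0 T) : ContinuousOn (fun ρ => ξ ρ t) (Ioi 0) := by
  refine LipschitzOnWith.continuousOn (K := 1) (LipschitzOnWith.of_dist_le_mul ?_)
  intro r hr ρ hρ
  obtain ⟨d, hd⟩ := h r hr
  obtain ⟨e, he⟩ := h ρ hρ
  rw [Real.dist_eq, Real.dist_eq, NNReal.coe_one, one_mul]
  rcases le_total ρ r with hle | hle
  · exact (abs_sub_le_of_le hρ hle hd he ht).trans (le_abs_self _)
  · rw [abs_sub_comm, abs_sub_comm r]
    exact (abs_sub_le_of_le hr hle he hd ht).trans (le_abs_self _)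

end IsPlaySol

/-- A function whose increments are at most quadratic is nonincreasing. -/
theorem le_of_sub_le_mul_sq {f : ℝ → ℝ} {a b L : ℝ} (hab : a ≤ b)
    (h : ∀ s t, a ≤ s → s ≤ t → t ≤ b → f t - f s ≤ L * (t - s) ^ 2) : f b ≤ f a := by
  have key : ∀ n : ℕ, f b - f a ≤ L * (b - a) ^ 2 * (1 / ((n : ℝ) + 1)) := by
    intro n
    have hn : (0 : ℝ) < n + 1 := by positivity
    set δ := (b - a) / (n + 1) with hδ
    have hδ0 : 0 ≤ δ := div_nonneg (sub_nonneg.2 hab) hn.le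
    have hδn : (n + 1) * δ = b - a := mul_div_cancel₀ _ hn.ne'
    have hsum := Finset.sum_range_sub (fun k : ℕ => f (a + k * δ)) (n + 1)
    have hle : ∑ k ∈ Finset.range (n + 1), (f (a + (k + 1 : ℕ) * δ) - f (a + k * δ)) ≤
        ∑ k ∈ Finset.range (n + 1), L * δ ^ 2 := by
      refine Finset.sum_le_sum fun k hk => ?_
      have hk' : ((k + 1 : ℕ) : ℝ) ≤ n + 1 := by
        exact_mod_cast Finset.mem_range.1 hk
      have h1 : ((k + 1 : ℕ) : ℝ) * δ ≤ (n + 1) * δ := mul_le_mul_of_nonneg_right hk' hδ0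
      have h2 : 0 ≤ (k : ℝ) * δ := by positivity
      refine (h _ _ (by linarith) ?_ (by linarith)).trans_eq ?_
      · push_cast
        linarith
      · push_cast
        ring
    rw [hsum] at hle
    simp only [Finset.sum_const, Finset.card_range, nsmul_eq_mul] at hle
    push_cast at hle
    rw [hδn, zero_mul, add_zero, add_sub_cancel] at hle
    refine hle.trans_eq ?_
    rw [hδ]
    field_simp
  have hlim := (tendsto_one_div_add_atTop_nhds_zero_nat (𝕜 := ℝ)).const_mul (L * (b - a) ^ 2)
  rw [mul_zero] at hlim
  linarith [ge_of_tendsto' hlim key]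

/-- A Gronwall inequality expressed through the superlevel sets of `x / m`. -/
theorem integral_le_of_superlevel {α : Type*} [MeasurableSpace α] {ν : Measure α} {x m : α → ℝ}
    (hx : Integrable x ν) (hm : Integrable m ν) (hx0 : ∀ a, 0 ≤ x a)
    (hm0 : ∀ᵐ a ∂ν, 0 ≤ m a) {b C : ℝ} (hb : 0 < b) (hC : 0 < C)
    (h : ∀ l, 0 < l → l ≤ C → b * ∫ a in {a | l * m a < x a}, x a ∂ν ≤ C - l) :
    ∫ a, x a ∂ν ≤ C / b * (1 - Real.exp (-(b * ∫ a, m a ∂ν))) := by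
  have hM : 0 ≤ ∫ a, m a ∂ν := integral_nonneg_of_ae hm0
  set M := ∫ a, m a ∂ν
  set Φ : ℝ → ℝ := fun s => ∫ a, max (s * x a - m a) 0 ∂ν with hΦ
  have hint : ∀ s, Integrable (fun a => max (s * x a - m a) 0) ν := fun s =>
    ((hx.const_mul s).sub hm).pos_part
  have hnull : ∀ l : ℝ, NullMeasurableSet {a | l * m a < x a} ν := fun l =>
    nullMeasurableSet_lt (hm.1.aemeasurable.const_mul l) hx.1.aemeasurable
  have hstep : ∀ s t, 1 / C ≤ s → s ≤ t → Φ t - Φ s ≤ (t - s) * ((C - 1 / t) / b) := by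
    intro s t hs hst
    have ht : 0 < t := (one_div_pos.2 hC).trans_le (hs.trans hst)
    have h1 : Φ t - Φ s ≤ (t - s) * ∫ a in {a | 1 / t * m a < x a}, x a ∂ν := by
      simp only [hΦ]
      rw [← integral_sub (hint t) (hint s), ← integral_const_mul,
        ← integral_indicator₀ (hnull _)]
      refine integral_mono ((hint t).sub (hint s))
        ((hx.const_mul _).integrableOn.integrable_indicator₀ (hnull _)) fun a => ?_
      have hxa := hx0 a
      have hsx : s * x a ≤ t * x a := mul_le_mul_of_nonneg_right hst hxa
      by_cases ha : 1 / t * m a < x a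
      · rw [indicator_of_mem (by exact ha)]
        rcases max_cases (t * x a - m a) 0 with h | h <;>
        rcases max_cases (s * x a - m a) 0 with h' | h' <;> nlinarith
      · rw [indicator_of_notMem (by exact ha)]
        have : t * x a ≤ m a := by
          rw [not_lt, one_div, ← div_eq_inv_mul, le_div_iff₀ ht] at ha
          linarith
        rw [max_eq_right (by linarith), max_eq_right (by linarith), sub_self]
    refine h1.trans (mul_le_mul_of_nonneg_left ?_ (sub_nonneg.2 hst))
    rw [le_div_iff₀ hb, mul_comm]
    refine h _ (one_div_pos.2 ht) ?_
    rw [one_div_le ht hC]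
    exact hs.trans hst
  have hΦ0 : Φ (1 / C) ≤ 0 := by
    have h1 : Φ (1 / C) ≤ 1 / C * ∫ a in {a | C * m a < x a}, x a ∂ν := by
      simp only [hΦ]
      rw [← integral_const_mul, ← integral_indicator₀ (hnull _)]
      refine integral_mono_ae (hint _)
        ((hx.const_mul _).integrableOn.integrable_indicator₀ (hnull _)) ?_
      filter_upwards [hm0] with a hma
      have hxa := hx0 a
      have hxC : 0 ≤ 1 / C * x a := by positivity
      by_cases ha : C * m a < x a
      · rw [indicator_of_mem (by exact ha)]
        exact max_le (by linarith) hxC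
      · rw [indicator_of_notMem (by exact ha)]
        refine max_le ?_ le_rfl
        rw [one_div, ← div_eq_inv_mul, sub_nonpos, div_le_iff₀ hC]
        linarith
    have h2 := h C hC le_rfl
    have h3 : ∫ a in {a | C * m a < x a}, x a ∂ν ≤ 0 := by
      by_contra! hpos
      nlinarith
    exact h1.trans (mul_nonpos_of_nonneg_of_nonpos (by positivity) h3)
  set S := Real.exp (b * M) / C with hS
  have hCS : 1 / C ≤ S := by
    rw [hS]
    gcongr
    exact Real.one_le_exp (by positivity)
  have hmono := le_of_sub_le_mul_sq (f := fun s => Φ s - (C * s - Real.log s) / b)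
    (L := C ^ 2 / b) hCS fun s t hs hst _ => by
      have hs0 : 0 < s := (one_div_pos.2 hC).trans_le hs
      have ht0 : 0 < t := hs0.trans_le hst
      have hlog : Real.log t - Real.log s ≤ t / s - 1 := by
        rw [← Real.log_div ht0.ne' hs0.ne']
        exact Real.log_le_sub_one_of_pos (by positivity)
      have hCs : 1 ≤ C * s := by rwa [div_le_iff₀' hC] at hs
      have hCt : 1 ≤ C * t := hCs.trans (mul_le_mul_of_nonneg_left hst hC.le)
      have h1 : (t / s - 1) - (t - s) / t ≤ C ^ 2 * (t - s) ^ 2 := by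
        have : (t / s - 1) - (t - s) / t = (t - s) ^ 2 / (s * t) := by
          field_simp
        rw [this, div_le_iff₀ (by positivity)]
        have h11 : 1 ≤ (C * s) * (C * t) := one_le_mul_of_one_le_of_one_le hCs hCt
        nlinarith [mul_le_mul_of_nonneg_left h11 (sq_nonneg (t - s))]
      have h2 := hstep s t hs hst
      have h3 : (t - s) * ((C - 1 / t) / b) = (C * (t - s) - (t - s) / t) / b := by
        field_simp
      have h4 : (C * (t - s) - (t - s) / t) / b - ((C * t - Real.log t) / b -
          (C * s - Real.log s) / b) ≤ C ^ 2 / b * (t - s) ^ 2 := by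
        have : (C * (t - s) - (t - s) / t) / b - ((C * t - Real.log t) / b -
          (C * s - Real.log s) / b) = ((Real.log t - Real.log s) - (t - s) / t) / b := by
          ring
        rw [this, div_mul_eq_mul_div]
        gcongr
        linarith
      linarith
  have hlow : S * ∫ a, x a ∂ν - M ≤ Φ S := by
    rw [← integral_const_mul, ← integral_sub (hx.const_mul _) hm]
    exact integral_mono ((hx.const_mul _).sub hm) (hint _) fun a => le_max_left _ _
  have hlogS : Real.log S = b * M - Real.log C := by
    rw [hS, Real.log_div (Real.exp_ne_zero _) hC.ne', Real.log_exp]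
  have hlogC : Real.log (1 / C) = - Real.log C := by simp
  have hE := Real.exp_pos (b * M)
  simp only [hlogS, hlogC] at hmono
  have h5 : (C * S - (b * M - Real.log C)) / b - (C * (1 / C) - -Real.log C) / b
      = (Real.exp (b * M) - 1) / b - M := by
    rw [hS]
    field_simp
    ring
  have h6 : S * ∫ a, x a ∂ν ≤ (Real.exp (b * M) - 1) / b := by linarith
  have hS0 : 0 < S := by positivity
  rw [← le_div_iff₀' hS0] at h6
  refine h6.trans_eq ?_
  rw [hS, Real.exp_neg]
  field_simp

section Preisach

variable {T bbar ε K : ℝ} {g : ℝ → ℝ → ℝ} {μ b q₁ q₂ q₁' q₂' : ℝ → ℝ} {ξ₁ ξ₂ : ℝ → ℝ → ℝ}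

theorem integral_neg_part_le (hg : IsPreisachDensity g μ) (hbbar : 0 < bbar) (hε : 0 < ε)
    (hb : ∀ t ∈ Icc 0 T, 0 ≤ b t ∧ b t ≤ bbar)
    (hq₁ : IsACOn T q₁ q₁') (hq₂ : IsACOn T q₂ q₂')
    (hξ₁ : ∀ ρ : ℝ, 0 < ρ → ∃ d, IsPlaySol T ρ q₁ (ξ₁ ρ) d)
    (hξ₂ : ∀ ρ : ℝ, 0 < ρ → ∃ d, IsPlaySol T ρ q₂ (ξ₂ ρ) d)
    (hint : ∀ t ∈ Icc 0 T, IntegrableOn (fun ρ => g ρ (ξ₁ ρ t) - g ρ (ξ₂ ρ t)) (Ioi 0))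
    (hQ : ∀ t ∈ Icc 0 T,
      |q₁ t - q₂ t + b t * ∫ ρ in Ioi (0:ℝ), (g ρ (ξ₁ ρ t) - g ρ (ξ₂ ρ t))| ≤ ε)
    (hN : ∀ t ∈ Icc 0 T, ∫ ρ in Ioi (0:ℝ), max (g ρ (ξ₂ ρ t) - g ρ (ξ₁ ρ t)) 0 ≤ K)
    (hP : ∀ t ∈ Icc 0 T, ∫ ρ in Ioi (0:ℝ), max (g ρ (ξ₁ ρ t) - g ρ (ξ₂ ρ t)) 0 ≤ K)
    {t : ℝ} (ht : t ∈ Icc 0 T) :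
    ∫ ρ in Ioi (0:ℝ), max (g ρ (ξ₂ ρ t) - g ρ (ξ₁ ρ t)) 0 ≤
      (ε + bbar * K) / bbar * (1 - Real.exp (-(bbar * ∫ ρ in Ioi (0:ℝ), μ ρ))) := by
  have hK : 0 ≤ K := (integral_nonneg fun _ => le_max_right _ _).trans (hN t ht)
  have hintP := fun s hs => (hint s hs).pos_part
  have hintN : ∀ s ∈ Icc 0 T,
      IntegrableOn (fun ρ => max (g ρ (ξ₂ ρ s) - g ρ (ξ₁ ρ s)) 0) (Ioi 0) := fun s hs => by
    simpa only [IntegrableOn, neg_sub] using (hint s hs).neg_part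
  have hgood := hg.2.2
  refine integral_le_of_superlevel (hintN t ht) hg.2.1 (fun _ => le_max_right _ _)
    (hgood.mono fun _ h => h.2.1) hbbar (by positivity) fun l hl hlC => ?_
  set A := {ρ | l * μ ρ < max (g ρ (ξ₂ ρ t) - g ρ (ξ₁ ρ t)) 0} with hA
  have hAξ : ∀ᵐ ρ ∂(volume.restrict (Ioi (0:ℝ))), ρ ∈ A → ξ₁ ρ t - ξ₂ ρ t < -l := by
    filter_upwards [hgood] with ρ hρ hρA
    obtain ⟨-, hμ, hmono, hlip⟩ := hρ
    have hρA' : l * μ ρ < g ρ (ξ₂ ρ t) - g ρ (ξ₁ ρ t) := by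
      rcases lt_max_iff.1 (mem_ofPred_eq ▸ hρA) with h | h
      · exact h
      · exact absurd h (mul_nonneg hl.le hμ).not_gt
    have hlt : ξ₁ ρ t < ξ₂ ρ t := by
      by_contra! hle
      have := hmono hle
      nlinarith
    have h1 := hlip.dist_le_mul (ξ₂ ρ t) (ξ₁ ρ t)
    rw [Real.dist_eq, Real.dist_eq, Real.coe_toNNReal _ hμ, abs_of_pos (sub_pos.2 hlt)] at h1
    have h2 := hρA'.trans_le ((le_abs_self _).trans h1)
    rw [mul_comm] at h2
    linarith [lt_of_mul_lt_mul_left h2 hμ]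
  by_cases hex : ∃ ρ, 0 < ρ ∧ ξ₁ ρ t - ξ₂ ρ t < -l
  swap
  · have hnull : (volume.restrict (Ioi (0:ℝ))) A = 0 := by
      rw [measure_eq_zero_iff_ae_notMem]
      filter_upwards [hAξ, ae_restrict_mem measurableSet_Ioi] with ρ hρ hρ0 hρA
      exact hex ⟨ρ, hρ0, hρ hρA⟩
    rw [setIntegral_measure_zero _ hnull]
    linarith
  obtain ⟨ρ₀, hρ₀, hlt₀⟩ := hex
  obtain ⟨d₁, hd₁⟩ := hξ₁ ρ₀ hρ₀
  obtain ⟨d₂, hd₂⟩ := hξ₂ ρ₀ hρ₀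
  obtain ⟨s, hs, hsl⟩ := hd₁.exists_input_sub_le hρ₀ hd₂ (neg_neg_of_pos hl) ht hlt₀
  have hcont : ContinuousOn (fun τ => q₁ τ - q₂ τ) (Icc 0 t) :=
    (hq₁.sub hq₂).continuousOn.mono (Icc_subset_Icc_right ht.2)
  have hcomp : IsCompact (Icc 0 t ∩ (fun τ => q₁ τ - q₂ τ) ⁻¹' Iic (-l)) :=
    isCompact_Icc.of_isClosed_subset (hcont.preimage_isClosed_of_isClosed isClosed_Icc isClosed_Iic)
      inter_subset_left
  obtain ⟨u, ⟨hu, hul⟩, hmax⟩ := hcomp.exists_isGreatest ⟨s, hs, hsl⟩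
  have hafter : ∀ τ ∈ Ioc u t, -l < q₁ τ - q₂ τ := fun τ hτ => by
    by_contra! hle
    exact (hmax ⟨⟨hu.1.trans hτ.1.le, hτ.2⟩, hle⟩).not_gt hτ.1
  have huT : u ∈ Icc 0 T := ⟨hu.1, hu.2.trans ht.2⟩
  have hAnull : NullMeasurableSet A (volume.restrict (Ioi (0:ℝ))) :=
    nullMeasurableSet_lt (hg.2.1.1.aemeasurable.const_mul l) (hintN t ht).1.aemeasurable
  have hXN : ∫ ρ in A, max (g ρ (ξ₂ ρ t) - g ρ (ξ₁ ρ t)) 0 ∂(volume.restrict (Ioi (0:ℝ))) ≤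
      ∫ ρ in Ioi (0:ℝ), max (g ρ (ξ₂ ρ u) - g ρ (ξ₁ ρ u)) 0 := by
    rw [← integral_indicator₀ hAnull]
    refine integral_mono_ae ((hintN t ht).integrableOn.integrable_indicator₀ hAnull)
      (hintN u huT) ?_
    filter_upwards [hAξ, hgood, ae_restrict_mem measurableSet_Ioi] with ρ hρA hρ hρ0
    by_cases hmem : ρ ∈ A
    · rw [indicator_of_mem hmem]
      obtain ⟨d₁, hd₁⟩ := hξ₁ ρ hρ0
      obtain ⟨d₂, hd₂⟩ := hξ₂ ρ hρ0
      have := hd₁.mono_of_input_sub_lt hρ0 hd₂ hu.1 hu.2 ht.2 (hρA hmem) hafter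
      exact max_le_max (sub_le_sub (hρ.2.2.1 this.2) (hρ.2.2.1 this.1)) le_rfl
    · rw [indicator_of_notMem hmem]
      exact le_max_right _ _
  have hPN : ∫ ρ in Ioi (0:ℝ), (g ρ (ξ₁ ρ u) - g ρ (ξ₂ ρ u)) =
      (∫ ρ in Ioi (0:ℝ), max (g ρ (ξ₁ ρ u) - g ρ (ξ₂ ρ u)) 0) -
      ∫ ρ in Ioi (0:ℝ), max (g ρ (ξ₂ ρ u) - g ρ (ξ₁ ρ u)) 0 := by
    rw [← integral_sub (hintP u huT) (hintN u huT)]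
    congr 1 with ρ
    grind
  have hQu := (abs_le.1 (hQ u huT)).1
  rw [hPN] at hQu
  have hNu := hN u huT
  have hPu := hP u huT
  set N := ∫ ρ in Ioi (0:ℝ), max (g ρ (ξ₂ ρ u) - g ρ (ξ₁ ρ u)) 0
  set P := ∫ ρ in Ioi (0:ℝ), max (g ρ (ξ₁ ρ u) - g ρ (ξ₂ ρ u)) 0
  have hul' : q₁ u - q₂ u ≤ -l := hul
  have hbu := hb u huT
  have hbound : b u * (P - N) ≤ bbar * (K - N) :=
    (mul_le_mul_of_nonneg_left (sub_le_sub_right hPu N) hbu.1).trans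
      (mul_le_mul_of_nonneg_right hbu.2 (sub_nonneg.2 hNu))
  have := mul_le_mul_of_nonneg_left hXN hbbar.le
  linarith

theorem abs_input_sub_le_of_pos (hg : IsPreisachDensity g μ) (hε : 0 < ε)
    (hb : ∀ t ∈ Icc 0 T, 0 ≤ b t ∧ b t ≤ bbar)
    (hq₁ : IsACOn T q₁ q₁') (hq₂ : IsACOn T q₂ q₂')
    (hξ₁ : ∀ ρ : ℝ, 0 < ρ → ∃ d, IsPlaySol T ρ q₁ (ξ₁ ρ) d)
    (hξ₂ : ∀ ρ : ℝ, 0 < ρ → ∃ d, IsPlaySol T ρ q₂ (ξ₂ ρ) d)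
    (hint : ∀ t ∈ Icc 0 T, IntegrableOn (fun ρ => g ρ (ξ₁ ρ t) - g ρ (ξ₂ ρ t)) (Ioi 0))
    (hK : ∀ t ∈ Icc 0 T, ∫ ρ in Ioi (0:ℝ), |g ρ (ξ₁ ρ t) - g ρ (ξ₂ ρ t)| ≤ K)
    (hQ : ∀ t ∈ Icc 0 T,
      |q₁ t - q₂ t + b t * ∫ ρ in Ioi (0:ℝ), (g ρ (ξ₁ ρ t) - g ρ (ξ₂ ρ t))| ≤ ε)
    {t : ℝ} (ht : t ∈ Icc 0 T) :
    |q₁ t - q₂ t| ≤ Real.exp (bbar * ∫ ρ in Ioi (0:ℝ), μ ρ) * ε := by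
  have hbbar : 0 ≤ bbar := (hb t ht).1.trans (hb t ht).2
  rcases hbbar.eq_or_lt with rfl | hbbar
  · have h0 : b t = 0 := le_antisymm (hb t ht).2 (hb t ht).1
    simpa [h0] using hQ t ht
  have hint' : ∀ s ∈ Icc 0 T,
      IntegrableOn (fun ρ => g ρ (ξ₂ ρ s) - g ρ (ξ₁ ρ s)) (Ioi 0) := fun s hs => by
    simpa only [Pi.neg_def, neg_sub] using (hint s hs).neg
  have hQ' : ∀ s ∈ Icc 0 T,
      |q₂ s - q₁ s + b s * ∫ ρ in Ioi (0:ℝ), (g ρ (ξ₂ ρ s) - g ρ (ξ₁ ρ s))| ≤ ε := fun s hs => by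
    rw [← abs_neg]
    convert hQ s hs using 2
    rw [neg_add, neg_sub, ← mul_neg, ← integral_neg]
    simp only [neg_sub]
  set N : ℝ → ℝ := fun s => ∫ ρ in Ioi (0:ℝ), max (g ρ (ξ₂ ρ s) - g ρ (ξ₁ ρ s)) 0 with hNdef
  set P : ℝ → ℝ := fun s => ∫ ρ in Ioi (0:ℝ), max (g ρ (ξ₁ ρ s) - g ρ (ξ₂ ρ s)) 0 with hPdef
  set S := N '' Icc 0 T ∪ P '' Icc 0 T with hS
  have hSbdd : BddAbove S := by
    refine ⟨K, ?_⟩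
    rintro _ (⟨s, hs, rfl⟩ | ⟨s, hs, rfl⟩)
    · refine (integral_mono (hint' s hs).pos_part (hint s hs).abs fun ρ => ?_).trans (hK s hs)
      rw [abs_sub_comm]
      exact max_le (le_abs_self _) (abs_nonneg _)
    · refine (integral_mono (hint s hs).pos_part (hint s hs).abs fun ρ => ?_).trans (hK s hs)
      exact max_le (le_abs_self _) (abs_nonneg _)
  have hNS : ∀ s ∈ Icc 0 T, N s ≤ sSup S := fun s hs =>
    le_csSup hSbdd (Or.inl (mem_image_of_mem _ hs))
  have hPS : ∀ s ∈ Icc 0 T, P s ≤ sSup S := fun s hs =>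
    le_csSup hSbdd (Or.inr (mem_image_of_mem _ hs))
  have hfix : sSup S ≤ (ε + bbar * sSup S) / bbar *
      (1 - Real.exp (-(bbar * ∫ ρ in Ioi (0:ℝ), μ ρ))) := by
    refine csSup_le ⟨N t, Or.inl (mem_image_of_mem _ ht)⟩ ?_
    rintro _ (⟨s, hs, rfl⟩ | ⟨s, hs, rfl⟩)
    · exact integral_neg_part_le hg hbbar hε hb hq₁ hq₂ hξ₁ hξ₂ hint hQ hNS hPS hs
    · exact integral_neg_part_le hg hbbar hε hb hq₂ hq₁ hξ₂ hξ₁ hint' hQ' hPS hNS hs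
  have hE := Real.exp_pos (bbar * ∫ ρ in Ioi (0:ℝ), μ ρ)
  rw [Real.exp_neg] at hfix
  set E := Real.exp (bbar * ∫ ρ in Ioi (0:ℝ), μ ρ)
  have hfix' : ε + bbar * sSup S ≤ E * ε := by
    rw [div_mul_eq_mul_div, le_div_iff₀ hbbar] at hfix
    have : (ε + bbar * sSup S) * E⁻¹ ≤ ε := by linarith
    rw [← div_eq_mul_inv, div_le_iff₀ hE] at this
    linarith
  refine le_trans ?_ hfix'
  have hPN : ∫ ρ in Ioi (0:ℝ), (g ρ (ξ₁ ρ t) - g ρ (ξ₂ ρ t)) = P t - N t := by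
    rw [← integral_sub (hint t ht).pos_part (hint' t ht).pos_part]
    congr 1 with ρ
    grind
  have hQt := hQ t ht
  rw [hPN] at hQt
  have hN0 : 0 ≤ N t := integral_nonneg fun _ => le_max_right _ _
  have hP0 : 0 ≤ P t := integral_nonneg fun _ => le_max_right _ _
  have hNt := hNS t ht
  have hPt := hPS t ht
  have hb1 : |b t * (P t - N t)| ≤ bbar * sSup S := by
    rw [abs_mul, abs_of_nonneg (hb t ht).1]
    exact mul_le_mul (hb t ht).2 (abs_le.2 ⟨by linarith, by linarith⟩) (abs_nonneg _) hbbar.le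
  rw [abs_le] at *
  constructor <;> linarith [hQt.1, hQt.2, hb1.1, hb1.2]

theorem abs_input_sub_le (hg : IsPreisachDensity g μ)
    (hb : ∀ t ∈ Icc 0 T, 0 ≤ b t ∧ b t ≤ bbar)
    (hq₁ : IsACOn T q₁ q₁') (hq₂ : IsACOn T q₂ q₂')
    (hξ₁ : ∀ ρ : ℝ, 0 < ρ → ∃ d, IsPlaySol T ρ q₁ (ξ₁ ρ) d)
    (hξ₂ : ∀ ρ : ℝ, 0 < ρ → ∃ d, IsPlaySol T ρ q₂ (ξ₂ ρ) d)
    (hint : ∀ t ∈ Icc 0 T, IntegrableOn (fun ρ => g ρ (ξ₁ ρ t) - g ρ (ξ₂ ρ t)) (Ioi 0))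
    (hK : ∀ t ∈ Icc 0 T, ∫ ρ in Ioi (0:ℝ), |g ρ (ξ₁ ρ t) - g ρ (ξ₂ ρ t)| ≤ K)
    (hQ : ∀ t ∈ Icc 0 T,
      |q₁ t - q₂ t + b t * ∫ ρ in Ioi (0:ℝ), (g ρ (ξ₁ ρ t) - g ρ (ξ₂ ρ t))| ≤ ε)
    {t : ℝ} (ht : t ∈ Icc 0 T) :
    |q₁ t - q₂ t| ≤ Real.exp (bbar * ∫ ρ in Ioi (0:ℝ), μ ρ) * ε := by
  have hε : 0 ≤ ε := (abs_nonneg _).trans (hQ t ht)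
  have hE := Real.exp_pos (bbar * ∫ ρ in Ioi (0:ℝ), μ ρ)
  rw [← div_le_iff₀' hE]
  refine le_of_forall_pos_le_add fun δ hδ => ?_
  rw [div_le_iff₀' hE]
  exact abs_input_sub_le_of_pos hg (by positivity) hb hq₁ hq₂ hξ₁ hξ₂ hint hK
    (fun s hs => (hQ s hs).trans (le_add_of_nonneg_right hδ.le)) ht

theorem IsPreisachDensity.aestronglyMeasurable_play (hg : IsPreisachDensity g μ)
    (hξ : ∀ ρ : ℝ, 0 < ρ → ∃ d, IsPlaySol T ρ q₁ (ξ₁ ρ) d) {t : ℝ} (ht : t ∈ Icc 0 T) :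
    AEStronglyMeasurable (fun ρ => g ρ (ξ₁ ρ t)) (volume.restrict (Ioi 0)) := by
  have hm : AEMeasurable (fun ρ => ξ₁ ρ t) (volume.restrict (Ioi 0)) :=
    (IsPlaySol.continuousOn_threshold hξ ht).aemeasurable measurableSet_Ioi
  exact (hg.1.comp_aemeasurable (aemeasurable_id.prodMk hm)).aestronglyMeasurable

theorem ae_abs_sub_le_osc
    (hgbdd : ∀ᵐ ρ ∂(volume.restrict (Ioi (0:ℝ))),
      BddAbove (Set.range (g ρ)) ∧ BddBelow (Set.range (g ρ))) :
    ∀ᵐ ρ ∂(volume.restrict (Ioi (0:ℝ))), ∀ v w,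
      |g ρ v - g ρ w| ≤ sSup (Set.range (g ρ)) - sInf (Set.range (g ρ)) := by
  filter_upwards [hgbdd] with ρ hρ v w
  have hv := le_csSup hρ.1 (mem_range_self v)
  have hw := le_csSup hρ.1 (mem_range_self w)
  have hv' := csInf_le hρ.2 (mem_range_self v)
  have hw' := csInf_le hρ.2 (mem_range_self w)
  rw [abs_le]
  constructor <;> linarith

end Preisach

/-- Proposition 3: Lipschitz dependence of the inverse mapping also on the
coefficient `b`: `‖q₁ - q₂‖ ≤ exp(b̄ M)(‖w₁ - w₂‖ + M₁ ‖b₁ - b₂‖)`, where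
`M₁ = ∫₀^∞ (sup_v g(r,v) - inf_v g(r,v)) dr < ∞`. -/
theorem stmt_4 (T bbar M M₁ : ℝ) (hT : 0 < T)
    (g : ℝ → ℝ → ℝ) (μ : ℝ → ℝ) (hg : IsPreisachDensity g μ)
    (hM : M = ∫ ρ in Ioi (0:ℝ), μ ρ)
    (hgbdd : ∀ᵐ ρ ∂(volume.restrict (Ioi (0:ℝ))),
      BddAbove (Set.range (g ρ)) ∧ BddBelow (Set.range (g ρ)))
    (hoscint : IntegrableOn
      (fun ρ => sSup (Set.range (g ρ)) - sInf (Set.range (g ρ))) (Ioi 0))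
    (hM₁ : M₁ = ∫ ρ in Ioi (0:ℝ), (sSup (Set.range (g ρ)) - sInf (Set.range (g ρ))))
    (b₁ b₂ w₁ w₂ : ℝ → ℝ)
    (hb₁ : ContinuousOn b₁ (Icc 0 T)) (hb₂ : ContinuousOn b₂ (Icc 0 T))
    (hw₁ : ContinuousOn w₁ (Icc 0 T)) (hw₂ : ContinuousOn w₂ (Icc 0 T))
    (hbrange₁ : ∀ t ∈ Icc 0 T, 0 ≤ b₁ t ∧ b₁ t ≤ bbar)
    (hbrange₂ : ∀ t ∈ Icc 0 T, 0 ≤ b₂ t ∧ b₂ t ≤ bbar)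
    (q₁ q₂ q₁' q₂' : ℝ → ℝ) (hq₁ : IsACOn T q₁ q₁') (hq₂ : IsACOn T q₂ q₂')
    (ξ₁ ξ₂ : ℝ → ℝ → ℝ)
    (hξ₁ : ∀ ρ : ℝ, 0 < ρ → ∃ d, IsPlaySol T ρ q₁ (ξ₁ ρ) d)
    (hξ₂ : ∀ ρ : ℝ, 0 < ρ → ∃ d, IsPlaySol T ρ q₂ (ξ₂ ρ) d)
    (heq₁ : ∀ t ∈ Icc 0 T, q₁ t + b₁ t * ∫ ρ in Ioi (0:ℝ), g ρ (ξ₁ ρ t) = w₁ t)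
    (heq₂ : ∀ t ∈ Icc 0 T, q₂ t + b₂ t * ∫ ρ in Ioi (0:ℝ), g ρ (ξ₂ ρ t) = w₂ t) :
    (⨆ t : Icc (0:ℝ) T, |q₁ t - q₂ t|) ≤
      Real.exp (bbar * M) * ((⨆ t : Icc (0:ℝ) T, |w₁ t - w₂ t|) +
        M₁ * ⨆ t : Icc (0:ℝ) T, |b₁ t - b₂ t|) := by
  have hbdd : ∀ {f₁ f₂ : ℝ → ℝ}, ContinuousOn f₁ (Icc 0 T) → ContinuousOn f₂ (Icc 0 T) →
      ∀ t ∈ Icc 0 T, |f₁ t - f₂ t| ≤ ⨆ t : Icc (0:ℝ) T, |f₁ t - f₂ t| := fun {f₁ f₂} h₁ h₂ t ht => by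
    refine le_ciSup (f := fun t : Icc (0:ℝ) T => |f₁ t - f₂ t|) ?_ (⟨t, ht⟩ : Icc (0:ℝ) T)
    have := isCompact_Icc.bddAbove_image (h₁.sub h₂).abs
    rwa [image_eq_range] at this
  have hosc := ae_abs_sub_le_osc hgbdd
  have hM₁0 : 0 ≤ M₁ := by
    rw [hM₁]
    exact integral_nonneg_of_ae (hosc.mono fun ρ h => (abs_nonneg _).trans (h 0 0))
  have hint : ∀ {q : ℝ → ℝ} {ξ : ℝ → ℝ → ℝ},
      (∀ ρ : ℝ, 0 < ρ → ∃ d, IsPlaySol T ρ q (ξ ρ) d) → ∀ t ∈ Icc 0 T,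
      IntegrableOn (fun ρ => g ρ (ξ ρ t)) (Ioi 0) := fun {_ ξ} hξ t ht => by
    refine hoscint.mono' (hg.aestronglyMeasurable_play hξ ht) ?_
    filter_upwards [hosc, hg.2.2] with ρ hρ hρ0
    simpa [hρ0.1] using hρ (ξ ρ t) 0
  have hint₁ := hint hξ₁
  have hint₂ := hint hξ₂
  have hP₂ : ∀ t ∈ Icc 0 T, |∫ ρ in Ioi (0:ℝ), g ρ (ξ₂ ρ t)| ≤ M₁ := fun t ht => by
    rw [hM₁]
    refine (Real.norm_eq_abs _).symm.trans_le (norm_integral_le_of_norm_le hoscint ?_)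
    filter_upwards [hosc, hg.2.2] with ρ hρ hρ0
    simpa [hρ0.1] using hρ (ξ₂ ρ t) 0
  have : Nonempty (Icc (0:ℝ) T) := ⟨⟨0, le_rfl, hT.le⟩⟩
  refine ciSup_le fun ⟨t, ht⟩ => ?_
  rw [hM]
  refine abs_input_sub_le (K := M₁) hg hbrange₁ hq₁ hq₂ hξ₁ hξ₂
    (fun s hs => (hint₁ s hs).sub (hint₂ s hs)) (fun s hs => ?_) (fun s hs => ?_) ht
  · rw [hM₁]
    exact integral_mono_ae ((hint₁ s hs).sub (hint₂ s hs)).abs hoscint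
      (hosc.mono fun ρ h => h _ _)
  · have hrw : q₁ s - q₂ s + b₁ s * ∫ ρ in Ioi (0:ℝ), (g ρ (ξ₁ ρ s) - g ρ (ξ₂ ρ s)) =
        (w₁ s - w₂ s) - (∫ ρ in Ioi (0:ℝ), g ρ (ξ₂ ρ s)) * (b₁ s - b₂ s) := by
      rw [integral_sub (hint₁ s hs) (hint₂ s hs), ← heq₁ s hs, ← heq₂ s hs]
      ring
    rw [hrw]
    refine (abs_sub _ _).trans (add_le_add (hbdd hw₁ hw₂ s hs) ?_)
    rw [abs_mul]
    exact mul_le_mul (hP₂ s hs) (hbdd hb₁ hb₂ s hs) (abs_nonneg _) hM₁0
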